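/- (Theorem 4.3, second Riccati equation.) For every integer n ≥ 1, every index 1 ≤ j ≤ N and every t ∈ U with R_{n,j}(t) ≠ 0: δr_{n,j}(t) = 2·r_{n,j}(t)·(r_{n,j}(t) − γ_j)/R_{n,j}(t) − (n + Σ_{k=1}^N r_{n,k}(t))·R_{n,j}(t), where δ = Σ_{k=1}^N ∂/∂t_k. -/

import Mathlib

open MeasureTheory Polynomial

noncomputable def pd {N : ℕ} (j : Fin N) (f : (Fin N → ℝ) → ℝ) (x : Fin N → ℝ) : ℝ :=
  deriv (fun s => f (Function.update x j s)) (x j)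

open Filter Topology

/-- All exponential moments of `g` converge absolutely. -/
def HasExpMoments (g : ℝ → ℝ) : Prop :=
  ∀ c : ℝ, Integrable fun u => Real.exp (c * |u|) * g u

namespace HasExpMoments

variable {g : ℝ → ℝ}

theorem integrable (hg : HasExpMoments g) : Integrable g := by
  simpa using hg 0

theorem mul_of_le (hg : HasExpMoments g) {f : ℝ → ℝ} (hf : Measurable f) {C A : ℝ}
    (hle : ∀ u, |f u| ≤ C * Real.exp (A * |u|)) : HasExpMoments fun u => f u * g u := by
  intro c
  refine ((hg (A + c)).const_mul C).mono ?_ (.of_forall fun u => ?_)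
  · exact (by fun_prop : Measurable fun u : ℝ => Real.exp (c * |u|)).aestronglyMeasurable.mul
      (hf.aestronglyMeasurable.mul hg.integrable.1)
  · have hC : 0 ≤ C * Real.exp (A * |u|) := (abs_nonneg _).trans (hle u)
    have hC' : 0 ≤ C := by
      by_contra! h
      exact absurd hC (not_le.2 (mul_neg_of_neg_of_pos h (Real.exp_pos _)))
    simp only [Real.norm_eq_abs, abs_mul, Real.abs_exp, abs_of_nonneg hC', add_mul, Real.exp_add]
    calc Real.exp (c * |u|) * (|f u| * |g u|) = |f u| * (Real.exp (c * |u|) * |g u|) := by ring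
      _ ≤ C * Real.exp (A * |u|) * (Real.exp (c * |u|) * |g u|) := by gcongr; exact hle u
      _ = _ := by ring

theorem pow_mul (hg : HasExpMoments g) (k : ℕ) : HasExpMoments fun u => u ^ k * g u := by
  refine hg.mul_of_le (C := k.factorial) (A := 1) (by fun_prop) fun u => ?_
  have h := Real.pow_div_factorial_le_exp |u| (abs_nonneg u) k
  rw [div_le_iff₀ (by positivity)] at h
  rw [abs_pow, one_mul, mul_comm]
  exact h

theorem polynomial_mul (hg : HasExpMoments g) (q : ℝ[X]) : HasExpMoments fun u => q.eval u * g u := by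
  intro c
  simp only [eval_eq_sum_range, Finset.sum_mul, Finset.mul_sum]
  refine integrable_finsetSum _ fun k _ => ?_
  refine (((hg.pow_mul k) c).const_mul (q.coeff k)).congr (.of_forall fun u => ?_)
  beta_reduce
  ring

theorem gauss_shift_mul (hg : HasExpMoments g) (s : ℝ) :
    HasExpMoments fun u => Real.exp (-(2 * u * s + s ^ 2)) * g u := by
  refine hg.mul_of_le (C := 1) (A := 2 * |s|) (by fun_prop) fun u => ?_
  rw [Real.abs_exp, one_mul, Real.exp_le_exp]
  nlinarith [neg_abs_le (u * s), abs_mul u s, sq_nonneg s]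

theorem hasDerivAt_integral_gauss_shift (hg : HasExpMoments g) :
    HasDerivAt (fun s => ∫ u, Real.exp (-(2 * u * s + s ^ 2)) * g u) (-2 * ∫ u, u * g u) 0 := by
  have key := hasDerivAt_integral_of_dominated_loc_of_deriv_le (μ := volume) (x₀ := (0 : ℝ))
    (s := Metric.ball 0 1) (F := fun s u => Real.exp (-(2 * u * s + s ^ 2)) * g u)
    (F' := fun s u => Real.exp (-(2 * u * s + s ^ 2)) * (-(2 * u + 2 * s)) * g u)
    (bound := fun u => 2 * |Real.exp (3 * |u|) * g u|) (Metric.ball_mem_nhds _ one_pos)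
    (.of_forall fun s => (hg.gauss_shift_mul s).integrable.1) (hg.gauss_shift_mul 0).integrable
    ((by fun_prop : Measurable fun u : ℝ =>
      Real.exp (-(2 * u * 0 + 0 ^ 2)) * (-(2 * u + 2 * 0))).aestronglyMeasurable.mul
        hg.integrable.1)
    (.of_forall fun u s hs => ?_) ((hg 3).abs.const_mul 2) (.of_forall fun u s _ => ?_)
  · refine key.2.congr_deriv ?_
    rw [← integral_const_mul]
    congr 1
    ext u
    simp
    ring
  · rw [mem_ball_zero_iff, Real.norm_eq_abs] at hs
    have h1 : Real.exp (-(2 * u * s + s ^ 2)) ≤ Real.exp (2 * |u|) := by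
      rw [Real.exp_le_exp]
      nlinarith [neg_abs_le (u * s), abs_mul u s, sq_nonneg s, abs_nonneg u,
        mul_le_mul_of_nonneg_left hs.le (abs_nonneg u)]
    have h2 : |(-(2 * u + 2 * s))| ≤ 2 * Real.exp |u| := by
      rw [abs_neg]
      have := Real.add_one_le_exp |u|
      have h3 := abs_add_le (2 * u) (2 * s)
      rw [abs_mul, abs_mul, abs_two] at h3
      linarith
    have h4 : Real.exp (3 * |u|) = Real.exp (2 * |u|) * Real.exp |u| := by
      rw [← Real.exp_add]; ring_nf
    rw [Real.norm_eq_abs, abs_mul, abs_mul, abs_mul, Real.abs_exp, Real.abs_exp, h4]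
    calc _ ≤ Real.exp (2 * |u|) * (2 * Real.exp |u|) * |g u| := by gcongr
      _ = _ := by ring
  · have h1 : HasDerivAt (fun s : ℝ => -(2 * u * s + s ^ 2)) (-(2 * u + 2 * s)) s := by
      refine (((hasDerivAt_id s).const_mul (2 * u)).add (hasDerivAt_pow 2 s)).neg.congr_deriv ?_
      simp
    exact h1.exp.mul_const (g u)

end HasExpMoments

/-- The moment functional of a weight with all exponential moments. -/
noncomputable def HasExpMoments.functional {g : ℝ → ℝ} (hg : HasExpMoments g) : ℝ[X] →ₗ[ℝ] ℝ where
  toFun q := ∫ u, q.eval u * g u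
  map_add' p q := by
    simp only [eval_add, add_mul]
    exact integral_add (hg.polynomial_mul p).integrable (hg.polynomial_mul q).integrable
  map_smul' c q := by
    simp only [eval_smul, smul_eq_mul, mul_assoc, RingHom.id_apply]
    exact integral_const_mul c _

namespace HasExpMoments

variable {g : ℝ → ℝ}

theorem functional_apply (hg : HasExpMoments g) (q : ℝ[X]) :
    hg.functional q = ∫ u, q.eval u * g u := rfl

theorem functional_eq_sum (hg : HasExpMoments g) {q : ℝ[X]} {d : ℕ} (hq : q.natDegree ≤ d) :
    hg.functional q = ∑ k ∈ Finset.range (d + 1), q.coeff k * ∫ u, u ^ k * g u := by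
  conv_lhs => rw [q.as_sum_range_C_mul_X_pow' (Nat.lt_succ_of_le hq)]
  rw [map_sum]
  refine Finset.sum_congr rfl fun k _ => ?_
  rw [← smul_eq_C_mul, map_smul, functional_apply, smul_eq_mul]
  simp

theorem hasDerivAt_functional (hg : HasExpMoments g) {q : ℝ → ℝ[X]} {q' : ℝ[X]} {d : ℕ}
    (hdeg : ∀ᶠ s in 𝓝 0, (q s).natDegree ≤ d)
    (hq : ∀ k, HasDerivAt (fun s => (q s).coeff k) (q'.coeff k) 0) :
    HasDerivAt (fun s => (hg.gauss_shift_mul s).functional (q s))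
      (hg.functional q' - 2 * hg.functional (X * q 0)) 0 := by
  have hq' : q'.natDegree ≤ d := by
    refine natDegree_le_iff_coeff_eq_zero.2 fun k hk => (hq k).unique ?_
    refine (hasDerivAt_const (0 : ℝ) (0 : ℝ)).congr_of_eventuallyEq ?_
    filter_upwards [hdeg] with s hs
    exact coeff_eq_zero_of_natDegree_lt (hs.trans_lt hk)
  have hq0 : (q 0).natDegree ≤ d := hdeg.self_of_nhds
  have hsum : HasDerivAt (fun s => ∑ k ∈ Finset.range (d + 1), (q s).coeff k *
      ∫ u, Real.exp (-(2 * u * s + s ^ 2)) * (u ^ k * g u))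
      (∑ k ∈ Finset.range (d + 1), (q'.coeff k * (∫ u, u ^ k * g u) +
        (q 0).coeff k * (-2 * ∫ u, u * (u ^ k * g u)))) 0 := by
    refine HasDerivAt.fun_sum fun k _ => ?_
    refine ((hq k).mul (hg.pow_mul k).hasDerivAt_integral_gauss_shift).congr_deriv ?_
    simp
  refine (hsum.congr_of_eventuallyEq ?_).congr_deriv ?_
  rotate_left
  · have hX : hg.functional (X * q 0) = (hg.pow_mul 1).functional (q 0) := by
      simp only [functional_apply, eval_mul, eval_X, pow_one]
      congr 1
      ext u
      ring
    rw [hX, hg.functional_eq_sum hq', functional_eq_sum _ hq0, Finset.sum_add_distrib,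
      Finset.mul_sum, sub_eq_add_neg, ← Finset.sum_neg_distrib]
    congr 1
    refine Finset.sum_congr rfl fun k _ => ?_
    have : (fun u => u ^ k * (u ^ 1 * g u)) = fun u => u * (u ^ k * g u) := by ext u; ring
    rw [this]
    ring
  · filter_upwards [hdeg] with s hs
    rw [functional_eq_sum _ hs]
    refine Finset.sum_congr rfl fun k _ => ?_
    congr 2
    ext u
    ring

end HasExpMoments

theorem integral_deriv_eq_zero_of_off_finite {f f' : ℝ → ℝ} {S : Set ℝ} (hS : S.Finite)
    (hc : Continuous f) (hd : ∀ u ∉ S, HasDerivAt f (f' u) u) (hf : Integrable f)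
    (hf' : Integrable f') : ∫ u, f' u = 0 := by
  obtain ⟨a, ha⟩ := hS.bddAbove
  obtain ⟨b, hb⟩ := hS.bddBelow
  have h1 : Tendsto f atTop (𝓝 0) :=
    tendsto_zero_of_hasDerivAt_of_integrableOn_Ioi (a := a)
      (fun u hu => hd u fun hm => absurd (ha hm) (not_le.2 hu)) hf'.integrableOn hf.integrableOn
  have h2 : Tendsto f atBot (𝓝 0) :=
    tendsto_zero_of_hasDerivAt_of_integrableOn_Iic (a := b - 1)
      (fun u hu => hd u fun hm => by
        have := hb hm
        rw [Set.mem_Iic] at hu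
        linarith) hf'.integrableOn hf.integrableOn
  have h3 := intervalIntegral_tendsto_integral hf' tendsto_neg_atTop_atBot tendsto_id
  refine tendsto_nhds_unique h3 ?_
  have h4 := h1.sub (h2.comp tendsto_neg_atTop_atBot)
  rw [sub_zero] at h4
  refine h4.congr fun c => ?_
  exact (integral_eq_of_hasDerivAt_off_countable f f' hS.countable hc.continuousOn
    (fun u hu => hd u hu.2) hf'.intervalIntegrable).symm

theorem integrable_abs_rpow_mul_exp_neg_mul_sq {b : ℝ} (hb : 0 < b) {s : ℝ} (hs : -1 < s) :
    Integrable fun u : ℝ => |u| ^ s * Real.exp (-b * u ^ 2) := by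
  have hpos : IntegrableOn (fun u : ℝ => |u| ^ s * Real.exp (-b * u ^ 2)) (Set.Ioi 0) :=
    (integrableOn_rpow_mul_exp_neg_mul_sq hb hs).congr_fun
      (fun u hu => by rw [abs_of_pos hu]) measurableSet_Ioi
  rw [← integrableOn_univ, ← @Set.Iio_union_Ici _ _ (0 : ℝ), integrableOn_union,
    integrableOn_Ici_iff_integrableOn_Ioi]
  refine ⟨?_, hpos⟩
  rw [← (Measure.measurePreserving_neg (volume : Measure ℝ)).integrableOn_comp_preimage
      (Homeomorph.neg ℝ).measurableEmbedding]
  simpa [Function.comp_def] using hpos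

theorem HasExpMoments.mono {f g : ℝ → ℝ} (hg : HasExpMoments g) (hf : Measurable f)
    (hle : ∀ u, |f u| ≤ |g u|) : HasExpMoments f := by
  intro c
  refine (hg c).mono (by fun_prop : Measurable _).aestronglyMeasurable (.of_forall fun u => ?_)
  rw [norm_mul, norm_mul]
  exact mul_le_mul_of_nonneg_left (hle u) (norm_nonneg _)

theorem hasExpMoments_abs_sub_rpow_mul_exp_neg_sq (t : ℝ) {a : ℝ} (ha : -1 < a) :
    HasExpMoments fun u => |u - t| ^ a * Real.exp (-u ^ 2) := by
  intro c
  have h := ((integrable_abs_rpow_mul_exp_neg_mul_sq (b := 1 / 4) (by norm_num) ha).comp_sub_right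
    t).const_mul (Real.exp (c ^ 2 / 2 + t ^ 2 / 2))
  refine h.mono' (by fun_prop : Measurable _).aestronglyMeasurable (.of_forall fun u => ?_)
  have hexp : Real.exp (c * |u|) * Real.exp (-u ^ 2) ≤
      Real.exp (c ^ 2 / 2 + t ^ 2 / 2) * Real.exp (-(1 / 4) * (u - t) ^ 2) := by
    rw [← Real.exp_add, ← Real.exp_add, Real.exp_le_exp]
    nlinarith [sq_nonneg (c - |u|), sq_abs u, sq_nonneg (u + t)]
  rw [Real.norm_eq_abs, abs_of_nonneg (by positivity)]
  calc _ = |u - t| ^ a * (Real.exp (c * |u|) * Real.exp (-u ^ 2)) := by ring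
    _ ≤ |u - t| ^ a * (Real.exp (c ^ 2 / 2 + t ^ 2 / 2) * Real.exp (-(1 / 4) * (u - t) ^ 2)) := by
      gcongr
    _ = _ := by ring

theorem prod_abs_sub_rpow_le {ι : Type*} {γ : ι → ℝ} (hγ : ∀ j, 0 < γ j) (t : ι → ℝ) (s : Finset ι) (u : ℝ) :
    ∏ j ∈ s, |u - t j| ^ γ j ≤
      Real.exp (∑ j ∈ s, γ j * |t j|) * Real.exp ((∑ j ∈ s, γ j) * |u|) := by
  rw [Real.exp_sum, Finset.sum_mul, Real.exp_sum, ← Finset.prod_mul_distrib]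
  refine Finset.prod_le_prod (fun j _ => by positivity) fun j _ => ?_
  rw [← Real.exp_add, ← mul_add, mul_comm, Real.exp_mul]
  refine Real.rpow_le_rpow (abs_nonneg _) ?_ (hγ j).le
  have h1 := Real.add_one_le_exp (|t j| + |u|)
  have h2 := abs_sub u (t j)
  linarith

section SingularGaussian

variable {ι : Type*} [Fintype ι]

/-- The Gaussian weight multiplied by algebraic singularities of order `γ j` at `t j`. -/
noncomputable def singularGaussian (γ t : ι → ℝ) (u : ℝ) : ℝ :=
  Real.exp (-u ^ 2) * ∏ j, |u - t j| ^ γ j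

theorem measurable_singularGaussian (γ t : ι → ℝ) : Measurable (singularGaussian γ t) := by
  unfold singularGaussian
  fun_prop

theorem singularGaussian_self {γ : ι → ℝ} (t : ι → ℝ) {j : ι} (hγ : 0 < γ j) :
    singularGaussian γ t (t j) = 0 := by
  unfold singularGaussian
  rw [Finset.prod_eq_zero (Finset.mem_univ j), mul_zero]
  rw [sub_self, abs_zero, Real.zero_rpow hγ.ne']

theorem hasExpMoments_singularGaussian_div {γ : ι → ℝ} (hγ : ∀ j, 0 < γ j) (t : ι → ℝ) (j : ι) :
    HasExpMoments fun u => singularGaussian γ t u / (u - t j) := by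
  classical
  have h := (hasExpMoments_abs_sub_rpow_mul_exp_neg_sq (t j) (a := γ j - 1)
    (by linarith [hγ j])).mul_of_le
      (f := fun u => ∏ k ∈ Finset.univ.erase j, |u - t k| ^ γ k) (by fun_prop) fun u => by
        rw [abs_of_nonneg (by positivity)]
        exact prod_abs_sub_rpow_le hγ t (Finset.univ.erase j) u
  refine h.mono ((measurable_singularGaussian γ t).div (by fun_prop)) fun u => ?_
  rcases eq_or_ne u (t j) with rfl | hu
  · rw [sub_self, div_zero, abs_zero]
    exact abs_nonneg _
  · have hu' : 0 < |u - t j| := abs_pos.2 (sub_ne_zero.2 hu)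
    have hP : 0 ≤ ∏ k ∈ Finset.univ.erase j, |u - t k| ^ γ k :=
      Finset.prod_nonneg fun k _ => Real.rpow_nonneg (abs_nonneg _) _
    have hB : 0 ≤ |u - t j| ^ γ j / |u - t j| * Real.exp (-u ^ 2) := by positivity
    have hN : 0 ≤ Real.exp (-u ^ 2) *
        (|u - t j| ^ γ j * ∏ k ∈ Finset.univ.erase j, |u - t k| ^ γ k) := by positivity
    unfold singularGaussian
    rw [← Finset.mul_prod_erase _ _ (Finset.mem_univ j), Real.rpow_sub_one hu'.ne', abs_div,
      abs_of_nonneg hN, abs_mul, abs_of_nonneg hP, abs_of_nonneg hB]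
    refine le_of_eq ?_
    ring

theorem sub_mul_singularGaussian_div {γ : ι → ℝ} (t : ι → ℝ) {j : ι} (hγ : 0 < γ j) (u : ℝ) :
    (u - t j) * (singularGaussian γ t u / (u - t j)) = singularGaussian γ t u := by
  rcases eq_or_ne u (t j) with rfl | hu
  · simp [singularGaussian_self t hγ]
  · exact mul_div_cancel₀ _ (sub_ne_zero.2 hu)

theorem hasExpMoments_singularGaussian [Nonempty ι] {γ : ι → ℝ} (hγ : ∀ j, 0 < γ j) (t : ι → ℝ) :
    HasExpMoments (singularGaussian γ t) := by
  obtain ⟨j⟩ := ‹Nonempty ι›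
  have h := (hasExpMoments_singularGaussian_div hγ t j).polynomial_mul (X - C (t j))
  simpa [sub_mul_singularGaussian_div t (hγ j)] using h

theorem continuous_singularGaussian {γ : ι → ℝ} (hγ : ∀ j, 0 < γ j) (t : ι → ℝ) :
    Continuous (singularGaussian γ t) := by
  unfold singularGaussian
  refine Continuous.mul (by fun_prop) (continuous_finsetProd _ fun j _ => ?_)
  exact Continuous.rpow_const (by fun_prop) fun u => Or.inr (hγ j).le

theorem hasDerivAt_abs_sub_rpow {u t : ℝ} (hu : u ≠ t) (a : ℝ) :
    HasDerivAt (fun y => |y - t| ^ a) (a / (u - t) * |u - t| ^ a) u := by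
  have hut : u - t ≠ 0 := sub_ne_zero.2 hu
  have h0 : HasDerivAt (fun y => |y - t|) (SignType.sign (u - t) : ℝ) u :=
    (hasDerivAt_abs hut).comp_sub_const u t
  have h1 := h0.rpow_const (p := a) (Or.inl (abs_ne_zero.2 hut))
  refine h1.congr_deriv ?_
  rw [Real.rpow_sub_one (abs_ne_zero.2 hut)]
  rcases lt_or_gt_of_ne hut with h | h
  · simp [abs_of_neg h, sign_neg h]
    field_simp
    ring
  · simp [abs_of_pos h, sign_pos h]
    field_simp

theorem hasDerivAt_singularGaussian (γ t : ι → ℝ) {u : ℝ} (hu : ∀ j, u ≠ t j) :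
    HasDerivAt (singularGaussian γ t)
      ((-(2 * u) + ∑ j, γ j / (u - t j)) * singularGaussian γ t u) u := by
  classical
  have hprod : HasDerivAt (fun y => ∏ j, |y - t j| ^ γ j)
      ((∑ j, γ j / (u - t j)) * ∏ j, |u - t j| ^ γ j) u := by
    refine (HasDerivAt.fun_finsetProd fun j _ =>
      hasDerivAt_abs_sub_rpow (hu j) (γ j)).congr_deriv ?_
    rw [Finset.sum_mul]
    refine Finset.sum_congr rfl fun j _ => ?_
    rw [← Finset.prod_erase_mul _ _ (Finset.mem_univ j), smul_eq_mul]
    ring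
  have hexp : HasDerivAt (fun y : ℝ => Real.exp (-y ^ 2)) (Real.exp (-u ^ 2) * -(2 * u)) u := by
    refine HasDerivAt.exp ?_
    exact (hasDerivAt_pow 2 u).neg.congr_deriv (by simp)
  refine (hexp.mul hprod).congr_deriv ?_
  unfold singularGaussian
  ring

/-- Integration by parts against the weight (Pearson equation). -/
theorem singularGaussian_pearson [Nonempty ι] {γ : ι → ℝ} (hγ : ∀ j, 0 < γ j) (t : ι → ℝ)
    (q : ℝ[X]) :
    (hasExpMoments_singularGaussian hγ t).functional (derivative q) =
      2 * (hasExpMoments_singularGaussian hγ t).functional (X * q) -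
        ∑ j, γ j * (hasExpMoments_singularGaussian_div hγ t j).functional q := by
  have hW := hasExpMoments_singularGaussian hγ t
  have hV := hasExpMoments_singularGaussian_div hγ t
  have hI1 := (hW.polynomial_mul (derivative q)).integrable
  have hI2 := ((hW.polynomial_mul (X * q)).integrable).const_mul 2
  have hI12 : Integrable fun u => (derivative q).eval u * singularGaussian γ t u -
      2 * ((X * q).eval u * singularGaussian γ t u) := hI1.sub hI2
  have hI3 : Integrable fun u => ∑ j, γ j * (q.eval u * (singularGaussian γ t u / (u - t j))) :=
    integrable_finsetSum _ fun j _ => (((hV j).polynomial_mul q).integrable).const_mul (γ j)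
  have h0 := integral_deriv_eq_zero_of_off_finite (Set.finite_range t)
    (q.continuous.mul (continuous_singularGaussian hγ t)) (f' := fun u =>
      (derivative q).eval u * singularGaussian γ t u -
        2 * ((X * q).eval u * singularGaussian γ t u) +
          ∑ j, γ j * (q.eval u * (singularGaussian γ t u / (u - t j)))) ?_
    (hW.polynomial_mul q).integrable (hI12.add hI3)
  · rw [integral_add hI12 hI3, integral_sub hI1 hI2, integral_const_mul,
      integral_finsetSum _ fun j _ => (((hV j).polynomial_mul q).integrable).const_mul (γ j)] at h0
    simp only [integral_const_mul] at h0
    simp only [HasExpMoments.functional_apply]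
    linarith
  · intro u hu
    have hu' : ∀ j, u ≠ t j := fun j hj => hu ⟨j, hj.symm⟩
    refine ((q.hasDerivAt u).mul (hasDerivAt_singularGaussian γ t hu')).congr_deriv ?_
    have : ∑ j, γ j * (q.eval u * (singularGaussian γ t u / (u - t j))) =
        (∑ j, γ j / (u - t j)) * (q.eval u * singularGaussian γ t u) := by
      rw [Finset.sum_mul]
      exact Finset.sum_congr rfl fun j _ => by ring
    rw [this]
    simp
    ring

end SingularGaussian
/-- A sequence of monic polynomials, one in each degree, orthogonal for the functional `L`. -/
structure IsMonicOrthogonal (L : ℝ[X] →ₗ[ℝ] ℝ) (P : ℕ → ℝ[X]) : Prop where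
  monic : ∀ n, (P n).Monic
  natDegree : ∀ n, (P n).natDegree = n
  orthogonal : ∀ m n, m ≠ n → L (P m * P n) = 0

namespace IsMonicOrthogonal

variable {L : ℝ[X] →ₗ[ℝ] ℝ} {P : ℕ → ℝ[X]}

theorem coeff_self (hP : IsMonicOrthogonal L P) (n : ℕ) : (P n).coeff n = 1 := by
  have h := (hP.monic n).coeff_natDegree
  rwa [hP.natDegree n] at h

theorem natDegree_sub_C_mul_le (hP : IsMonicOrthogonal L P) {q : ℝ[X]} {d : ℕ}
    (hq : q.natDegree ≤ d + 1) : (q - C (q.coeff (d + 1)) * P (d + 1)).natDegree ≤ d := by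
  refine natDegree_le_iff_coeff_eq_zero.2 fun k hk => ?_
  rw [coeff_sub, coeff_C_mul]
  rcases (Nat.succ_le_of_lt hk).eq_or_lt with h | h
  · rw [← h, Nat.succ_eq_add_one, hP.coeff_self, mul_one, sub_self]
  · rw [coeff_eq_zero_of_natDegree_lt (hq.trans_lt h),
      coeff_eq_zero_of_natDegree_lt ((hP.natDegree (d + 1)).trans_lt h), mul_zero, sub_zero]

theorem apply_mul_of_natDegree_le (hP : IsMonicOrthogonal L P) {n d : ℕ} {q : ℝ[X]}
    (hq : q.natDegree ≤ d) (hd : d ≤ n) :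
    L (P n * q) = q.coeff n * L (P n * P n) := by
  induction d generalizing q with
  | zero =>
    obtain ⟨c, rfl⟩ := natDegree_eq_zero.1 (Nat.le_zero.1 hq)
    have h0 : P 0 = 1 := eq_one_of_monic_natDegree_zero (hP.monic 0) (hP.natDegree 0)
    have h1 : L (P n * C c) = c * L (P n * P 0) := by
      rw [h0, mul_comm (P n), ← smul_eq_C_mul, map_smul, smul_eq_mul, mul_one]
    rcases eq_or_ne n 0 with rfl | hn
    · rw [h1, coeff_C_zero]
    · rw [h1, hP.orthogonal n 0 hn, coeff_C_of_ne_zero hn, mul_zero, zero_mul]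
  | succ d ih =>
    have h1 := ih (hP.natDegree_sub_C_mul_le hq) (by omega)
    have h2 : L (P n * (C (q.coeff (d + 1)) * P (d + 1))) =
        q.coeff (d + 1) * L (P n * P (d + 1)) := by
      rw [mul_left_comm, ← smul_eq_C_mul, map_smul, smul_eq_mul]
    rw [mul_sub, map_sub, h2, coeff_sub, coeff_C_mul] at h1
    rcases hd.eq_or_lt with h | h
    · subst h
      rw [hP.coeff_self] at h1
      linarith
    · rw [hP.orthogonal n (d + 1) h.ne', coeff_eq_zero_of_natDegree_lt (p := P (d + 1))
        ((hP.natDegree _).trans_lt h)] at h1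
      linarith

theorem apply_mul_of_natDegree_lt (hP : IsMonicOrthogonal L P) {n : ℕ} {q : ℝ[X]}
    (hq : q.natDegree < n) : L (P n * q) = 0 := by
  rw [hP.apply_mul_of_natDegree_le hq.le le_rfl, coeff_eq_zero_of_natDegree_lt hq, zero_mul]

theorem eq_zero_of_apply_mul_eq_zero (hP : IsMonicOrthogonal L P)
    (hpos : ∀ n, L (P n * P n) ≠ 0) {q : ℝ[X]} {d : ℕ} (hq : q.natDegree ≤ d)
    (h : ∀ p : ℝ[X], p.natDegree ≤ d → L (q * p) = 0) : q = 0 := by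
  by_contra hne
  have h1 := h (P q.natDegree) (by rwa [hP.natDegree])
  rw [mul_comm, hP.apply_mul_of_natDegree_le le_rfl le_rfl] at h1
  exact (mul_ne_zero (by simpa using hne) (hpos _)) h1

theorem eq_of_apply_mul_eq (hP : IsMonicOrthogonal L P) (hpos : ∀ n, L (P n * P n) ≠ 0)
    {q₁ q₂ : ℝ[X]} {d : ℕ} (h₁ : q₁.natDegree ≤ d) (h₂ : q₂.natDegree ≤ d)
    (h : ∀ p : ℝ[X], p.natDegree ≤ d → L (q₁ * p) = L (q₂ * p)) : q₁ = q₂ := by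
  refine sub_eq_zero.1 (hP.eq_zero_of_apply_mul_eq_zero hpos
    ((natDegree_sub_le _ _).trans (max_le h₁ h₂)) fun p hp => ?_)
  rw [sub_mul, map_sub, h p hp, sub_self]

theorem apply_succ_mul_X_mul (hP : IsMonicOrthogonal L P) {m : ℕ} {q : ℝ[X]}
    (hq : q.natDegree ≤ m) :
    L (P (m + 1) * (X * q)) = q.coeff m * L (P (m + 1) * P (m + 1)) := by
  rw [hP.apply_mul_of_natDegree_le (d := m + 1) _ le_rfl, coeff_X_mul]
  exact natDegree_mul_le.trans (by rw [natDegree_X]; omega)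

/-- A quadratic identity for the Cauchy transforms of `P (m + 1) ^ 2`, `P (m + 1) * P m` and
`P m ^ 2` at `t`, where `V` is the functional with weight divided by `X - t`. -/
theorem cauchy_transform_identity (hP : IsMonicOrthogonal L P) {V : ℝ[X] →ₗ[ℝ] ℝ} {t : ℝ}
    (hV : ∀ q, V ((X - C t) * q) = L q) (m : ℕ) :
    V (P (m + 1) * P m) * (V (P (m + 1) * P m) - L (P m * P m)) =
      V (P (m + 1) * P (m + 1)) * V (P m * P m) := by
  have hdiv : ∀ q p : ℝ[X], V (q * p) = p.eval t * V q + L (q * (p /ₘ (X - C t))) := by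
    intro q p
    conv_lhs => rw [← modByMonic_add_div p (X - C t), modByMonic_X_sub_C_eq_C_eval]
    rw [mul_add, map_add, mul_left_comm, hV, mul_comm q, ← smul_eq_C_mul, map_smul, smul_eq_mul]
  have hdeg : ∀ n, (P n /ₘ (X - C t)).natDegree = n - 1 := fun n => by
    rw [natDegree_divByMonic _ (monic_X_sub_C t), hP.natDegree, natDegree_X_sub_C]
  have hself : ∀ n, V (P n * P n) = (P n).eval t * V (P n) := by
    intro n
    rw [hdiv]
    rcases n with _ | n
    · have h0 : P 0 = 1 := eq_one_of_monic_natDegree_zero (hP.monic 0) (hP.natDegree 0)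
      have : (1 : ℝ[X]) /ₘ (X - C t) = 0 := by
        rw [divByMonic_eq_zero_iff (monic_X_sub_C t), degree_X_sub_C, degree_one]
        exact zero_lt_one
      rw [h0, this, mul_zero, map_zero, add_zero]
    · rw [hP.apply_mul_of_natDegree_lt (n := n + 1) (by rw [hdeg]; omega), add_zero]
  have h1 : V (P (m + 1) * P m) = (P m).eval t * V (P (m + 1)) := by
    rw [hdiv, hP.apply_mul_of_natDegree_lt (by rw [hdeg]; omega), add_zero]
  have h2 : V (P (m + 1) * P m) = (P (m + 1)).eval t * V (P m) + L (P m * P m) := by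
    have hc : (P (m + 1) /ₘ (X - C t)).coeff m = 1 := by
      have h3 := leadingCoeff_divByMonic_of_monic (monic_X_sub_C t) (p := P (m + 1))
        (by rw [degree_X_sub_C, degree_eq_natDegree (hP.monic _).ne_zero, hP.natDegree]
            exact_mod_cast Nat.le_add_left 1 m)
      rw [(hP.monic _).leadingCoeff, leadingCoeff, hdeg, Nat.add_sub_cancel] at h3
      exact h3
    rw [mul_comm, hdiv, hP.apply_mul_of_natDegree_le (d := m) (by rw [hdeg]; omega) le_rfl, hc,
      one_mul]
  rw [hself, hself]
  calc _ = ((P m).eval t * V (P (m + 1))) * ((P (m + 1)).eval t * V (P m)) := by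
        rw [← h1]; congr 1; linarith
    _ = _ := by ring

end IsMonicOrthogonal

theorem hasDerivAt_coeff_mul {p q : ℝ → ℝ[X]} {p' q' : ℝ[X]} {s : ℝ}
    (hp : ∀ k, HasDerivAt (fun s => (p s).coeff k) (p'.coeff k) s)
    (hq : ∀ k, HasDerivAt (fun s => (q s).coeff k) (q'.coeff k) s) (k : ℕ) :
    HasDerivAt (fun s => (p s * q s).coeff k) ((p' * q s + p s * q').coeff k) s := by
  simp only [coeff_add, coeff_mul, ← Finset.sum_add_distrib]
  exact HasDerivAt.fun_sum fun i _ => (hp i.1).mul (hq i.2)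

theorem exists_polynomial_hasDerivAt_coeff {q : ℝ → ℝ[X]} {d : ℕ} {s₀ : ℝ}
    (hdeg : ∀ᶠ s in 𝓝 s₀, (q s).natDegree ≤ d)
    (hq : ∀ k, DifferentiableAt ℝ (fun s => (q s).coeff k) s₀) :
    ∃ q' : ℝ[X], ∀ k, HasDerivAt (fun s => (q s).coeff k) (q'.coeff k) s₀ := by
  refine ⟨∑ i ∈ Finset.range (d + 1), C (deriv (fun s => (q s).coeff i) s₀) * X ^ i, fun k => ?_⟩
  rw [finsetSum_coeff]
  simp only [coeff_C_mul, coeff_X_pow, mul_ite, mul_one, mul_zero, Finset.sum_ite_eq,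
    Finset.mem_range]
  split_ifs with hk
  · exact (hq k).hasDerivAt
  · refine (hasDerivAt_const s₀ (0 : ℝ)).congr_of_eventuallyEq ?_
    filter_upwards [hdeg] with s hs
    exact coeff_eq_zero_of_natDegree_lt (by omega)

theorem differentiableAt_coeff_comp_X_add_C {p : ℝ → ℝ[X]} {d : ℕ} {s₀ : ℝ}
    (hdeg : ∀ᶠ s in 𝓝 s₀, (p s).natDegree ≤ d)
    (hp : ∀ k, DifferentiableAt ℝ (fun s => (p s).coeff k) s₀) (k : ℕ) :
    DifferentiableAt ℝ (fun s => ((p s).comp (X + C s)).coeff k) s₀ := by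
  have h : DifferentiableAt ℝ (fun s => ∑ i ∈ Finset.range (d + 1),
      (p s).coeff i * (s ^ (i - k) * (i.choose k : ℝ))) s₀ :=
    DifferentiableAt.fun_sum fun i _ => (hp i).mul (by fun_prop)
  refine h.congr_of_eventuallyEq ?_
  filter_upwards [hdeg] with s hs
  rw [comp_eq_sum_left, sum_over_range' _ (by simp) (d + 1) (Nat.lt_succ_of_le hs),
    finsetSum_coeff]
  simp only [coeff_C_mul, coeff_X_add_C_pow]

/-- A family of monic orthogonal polynomials `Q n s` for the Gaussian translates of a weight `g`,
whose coefficients have derivatives at `s = 0` given by those of `D n`. -/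
structure IsGaussFlow {g : ℝ → ℝ} (hg : HasExpMoments g) (Q : ℕ → ℝ → ℝ[X])
    (D : ℕ → ℝ[X]) : Prop where
  eventually_orthogonal : ∀ᶠ s in 𝓝 (0 : ℝ),
    IsMonicOrthogonal (hg.gauss_shift_mul s).functional fun n => Q n s
  hasDerivAt_coeff : ∀ n k, HasDerivAt (fun s => (Q n s).coeff k) ((D n).coeff k) 0
  norm_ne_zero : ∀ n, hg.functional (Q n 0 * Q n 0) ≠ 0

theorem HasExpMoments.functional_gauss_shift_zero {g : ℝ → ℝ} (hg : HasExpMoments g) :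
    (hg.gauss_shift_mul 0).functional = hg.functional := by
  ext k
  simp [functional_apply]

namespace IsGaussFlow

variable {g : ℝ → ℝ} {hg : HasExpMoments g} {Q : ℕ → ℝ → ℝ[X]} {D : ℕ → ℝ[X]}

theorem orthogonal (hF : IsGaussFlow hg Q D) :
    IsMonicOrthogonal hg.functional fun n => Q n 0 := by
  have h := hF.eventually_orthogonal.self_of_nhds
  rwa [hg.functional_gauss_shift_zero] at h

theorem coeff_eq_zero (hF : IsGaussFlow hg Q D) {n k : ℕ} (hk : n ≤ k) : (D n).coeff k = 0 := by
  obtain ⟨c, hc⟩ : ∃ c : ℝ, ∀ᶠ s in 𝓝 (0 : ℝ), (Q n s).coeff k = c := by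
    rcases hk.eq_or_lt with rfl | hk
    · exact ⟨1, hF.eventually_orthogonal.mono fun s hs => hs.coeff_self n⟩
    · exact ⟨0, hF.eventually_orthogonal.mono fun s hs =>
        coeff_eq_zero_of_natDegree_lt ((hs.natDegree n).trans_lt hk)⟩
  exact (hF.hasDerivAt_coeff n k).unique ((hasDerivAt_const (0 : ℝ) c).congr_of_eventuallyEq hc)

theorem natDegree_le (hF : IsGaussFlow hg Q D) (n : ℕ) : (D n).natDegree ≤ n - 1 :=
  natDegree_le_iff_coeff_eq_zero.2 fun _ hk => hF.coeff_eq_zero (by omega)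

theorem hasDerivAt_functional_mul (hF : IsGaussFlow hg Q D) {v : ℝ → ℝ} (hv : HasExpMoments v)
    (m n : ℕ) :
    HasDerivAt (fun s => (hv.gauss_shift_mul s).functional (Q m s * Q n s))
      (hv.functional (D m * Q n 0 + Q m 0 * D n) - 2 * hv.functional (X * (Q m 0 * Q n 0))) 0 := by
  refine hv.hasDerivAt_functional (d := m + n) ?_
    (hasDerivAt_coeff_mul (hF.hasDerivAt_coeff m) (hF.hasDerivAt_coeff n))
  filter_upwards [hF.eventually_orthogonal] with s hs
  exact natDegree_mul_le.trans (by rw [hs.natDegree, hs.natDegree])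

theorem functional_mul (hF : IsGaussFlow hg Q D) {n : ℕ} {q : ℝ[X]} (hq : q.natDegree < n) :
    hg.functional (D n * q) = 2 * hg.functional (Q n 0 * (X * q)) := by
  have h1 := hg.hasDerivAt_functional (d := n + q.natDegree)
    (by
      filter_upwards [hF.eventually_orthogonal] with s hs
      exact natDegree_mul_le.trans (by rw [hs.natDegree]))
    (hasDerivAt_coeff_mul (hF.hasDerivAt_coeff n) (q := fun _ => q) (q' := 0) fun k =>
      by simpa using hasDerivAt_const (0 : ℝ) (q.coeff k))
  have h2 := h1.unique ((hasDerivAt_const (0 : ℝ) (0 : ℝ)).congr_of_eventuallyEq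
    (hF.eventually_orthogonal.mono fun s hs => hs.apply_mul_of_natDegree_lt hq))
  rw [mul_zero, add_zero, mul_left_comm] at h2
  linarith

theorem deriv_succ_eq (hF : IsGaussFlow hg Q D) (m : ℕ) :
    D (m + 1) = C (2 * (hg.functional (Q (m + 1) 0 * Q (m + 1) 0) /
      hg.functional (Q m 0 * Q m 0))) * Q m 0 := by
  have hO := hF.orthogonal
  refine hO.eq_of_apply_mul_eq hF.norm_ne_zero (d := m) (hF.natDegree_le _)
    ((natDegree_C_mul_le _ _).trans (hO.natDegree m).le) fun q hq => ?_
  have hne := hF.norm_ne_zero m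
  rw [hF.functional_mul (Nat.lt_succ_of_le hq), hO.apply_succ_mul_X_mul hq, mul_assoc (C _),
    ← smul_eq_C_mul, map_smul, hO.apply_mul_of_natDegree_le hq le_rfl, smul_eq_mul]
  field_simp

theorem deriv_eq (hF : IsGaussFlow hg Q D) (m : ℕ) :
    D m = C 2 * (X * Q m 0 - Q (m + 1) 0 - C (hg.functional (X * (Q m 0 * Q m 0)) /
      hg.functional (Q m 0 * Q m 0)) * Q m 0) := by
  have hO := hF.orthogonal
  have hne := hF.norm_ne_zero m
  refine hO.eq_of_apply_mul_eq hF.norm_ne_zero (d := m)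
    ((hF.natDegree_le _).trans (Nat.sub_le _ _)) ?_ fun q hq => ?_
  · refine natDegree_le_iff_coeff_eq_zero.2 fun k hk => ?_
    have h1 : (Q m 0).coeff k = 0 := coeff_eq_zero_of_natDegree_lt ((hO.natDegree m).trans_lt hk)
    obtain ⟨k, rfl⟩ : ∃ l, k = l + 1 := ⟨k - 1, by omega⟩
    simp only [coeff_C_mul, coeff_sub, coeff_X_mul, h1, mul_zero, sub_zero]
    rcases (Nat.le_of_lt_succ hk).eq_or_lt with rfl | h
    · have h2 := hO.coeff_self m
      have h3 := hO.coeff_self (m + 1)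
      rw [h2, h3, sub_self, mul_zero]
    · rw [coeff_eq_zero_of_natDegree_lt ((hO.natDegree m).trans_lt h),
        coeff_eq_zero_of_natDegree_lt ((hO.natDegree (m + 1)).trans_lt (Nat.succ_lt_succ h)),
        sub_zero, mul_zero]
  · have hsucc : hg.functional (Q (m + 1) 0 * q) = 0 :=
      hO.apply_mul_of_natDegree_lt (n := m + 1) (Nat.lt_succ_of_le hq)
    have hexp : ∀ p : ℝ[X], C 2 * (X * Q m 0 - Q (m + 1) 0 - C (hg.functional
        (X * (Q m 0 * Q m 0)) / hg.functional (Q m 0 * Q m 0)) * Q m 0) * p =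
        (2 : ℝ) • (Q m 0 * (X * p) - Q (m + 1) 0 * p - (hg.functional (X * (Q m 0 * Q m 0)) /
          hg.functional (Q m 0 * Q m 0)) • (Q m 0 * p)) := fun p => by
      rw [smul_eq_C_mul, smul_eq_C_mul]; ring
    rw [hexp, map_smul, map_sub, map_sub, map_smul, hsucc, smul_eq_mul, smul_eq_mul, sub_zero]
    have hself : hg.functional (D m * Q m 0) = 0 := by
      rw [mul_comm, hO.apply_mul_of_natDegree_le (hF.natDegree_le m) (Nat.sub_le _ _),
        hF.coeff_eq_zero le_rfl, zero_mul]
    have hcm := hO.coeff_self m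
    obtain ⟨p, hp, hqp⟩ : ∃ p : ℝ[X], (p = 0 ∨ p.natDegree < m) ∧
        q = q.coeff m • Q m 0 + p := by
      refine ⟨q - C (q.coeff m) * Q m 0, ?_, by rw [smul_eq_C_mul]; ring⟩
      by_contra! hcon
      have hle : (q - C (q.coeff m) * Q m 0).natDegree ≤ m :=
        (natDegree_sub_le _ _).trans
          (max_le hq ((natDegree_C_mul_le _ _).trans (hO.natDegree m).le))
      have heq := le_antisymm hle hcon.2
      have hlead : (q - C (q.coeff m) * Q m 0).coeff m = 0 := by
        rw [coeff_sub, coeff_C_mul, hcm, mul_one, sub_self]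
      exact hcon.1 (leadingCoeff_eq_zero.1 (by rw [leadingCoeff, heq, hlead]))
    have hp1 : hg.functional (D m * p) = 2 * hg.functional (Q m 0 * (X * p)) := by
      rcases hp with rfl | hp
      · simp
      · exact hF.functional_mul hp
    have hp2 : hg.functional (Q m 0 * p) = 0 := by
      rcases hp with rfl | hp
      · simp
      · exact hO.apply_mul_of_natDegree_lt (n := m) hp
    have hX : Q m 0 * (X * Q m 0) = X * (Q m 0 * Q m 0) := by ring
    rw [hqp]
    simp only [mul_add, mul_smul_comm, map_add, map_smul, smul_eq_mul, hp1, hp2, hself, hX]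
    field_simp
    ring

theorem hasDerivAt_norm (hF : IsGaussFlow hg Q D) (m : ℕ) :
    HasDerivAt (fun s => (hg.gauss_shift_mul s).functional (Q m s * Q m s))
      (-2 * hg.functional (X * (Q m 0 * Q m 0))) 0 := by
  have hself : hg.functional (Q m 0 * D m) = 0 := by
    rw [hF.orthogonal.apply_mul_of_natDegree_le (hF.natDegree_le m) (Nat.sub_le _ _),
      hF.coeff_eq_zero le_rfl, zero_mul]
  refine (hF.hasDerivAt_functional_mul hg m m).congr_deriv ?_
  rw [map_add, mul_comm (D m), hself]
  ring

theorem hasDerivAt_quotient (hF : IsGaussFlow hg Q D) {v : ℝ → ℝ} (hv : HasExpMoments v) (m : ℕ) :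
    HasDerivAt (fun s => (hv.gauss_shift_mul s).functional (Q (m + 1) s * Q m s) /
        (hg.gauss_shift_mul s).functional (Q m s * Q m s))
      (2 * (hg.functional (Q (m + 1) 0 * Q (m + 1) 0) / hg.functional (Q m 0 * Q m 0) *
        hv.functional (Q m 0 * Q m 0) - hv.functional (Q (m + 1) 0 * Q (m + 1) 0)) /
          hg.functional (Q m 0 * Q m 0)) 0 := by
  have hne := hF.norm_ne_zero m
  have hne' : (hg.gauss_shift_mul 0).functional (Q m 0 * Q m 0) ≠ 0 := by
    rwa [hg.functional_gauss_shift_zero]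
  refine ((hF.hasDerivAt_functional_mul hv (m + 1) m).div (hF.hasDerivAt_norm m)
    hne').congr_deriv ?_
  have hexp : D (m + 1) * Q m 0 + Q (m + 1) 0 * D m =
      (2 * (hg.functional (Q (m + 1) 0 * Q (m + 1) 0) / hg.functional (Q m 0 * Q m 0))) •
        (Q m 0 * Q m 0) + (2 : ℝ) • (X * (Q (m + 1) 0 * Q m 0) - Q (m + 1) 0 * Q (m + 1) 0 -
          (hg.functional (X * (Q m 0 * Q m 0)) / hg.functional (Q m 0 * Q m 0)) •
            (Q (m + 1) 0 * Q m 0)) := by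
    rw [hF.deriv_succ_eq, hF.deriv_eq]
    simp only [smul_eq_C_mul]
    ring
  rw [hg.functional_gauss_shift_zero, hv.functional_gauss_shift_zero, hexp]
  simp only [map_add, map_sub, map_smul, smul_eq_mul]
  field_simp
  ring

end IsGaussFlow

theorem hasDerivAt_diagonal {N : ℕ} {f : (Fin N → ℝ) → ℝ} {x : Fin N → ℝ}
    (hf : DifferentiableAt ℝ f x) :
    HasDerivAt (fun s : ℝ => f fun i => x i + s) (∑ k, pd k f x) 0 := by
  have hpd : ∀ k, pd k f x = fderiv ℝ f x (Pi.single k 1) := fun k => by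
    have h1 : HasFDerivAt f (fderiv ℝ f x) (Function.update x k (x k)) := by
      rw [Function.update_eq_self]
      exact hf.hasFDerivAt
    exact (h1.comp_hasDerivAt (x k) (hasDerivAt_update x k (x k))).deriv
  have hsum : ∑ k, pd k f x = fderiv ℝ f x fun _ => 1 := by
    simp only [hpd]
    rw [← map_sum]
    congr 1
    ext i
    simp [Pi.single_apply]
  have h2 : HasDerivAt (fun s : ℝ => fun i => x i + s) (fun _ : Fin N => (1 : ℝ)) 0 :=
    hasDerivAt_pi.2 fun i => (hasDerivAt_id (0 : ℝ)).const_add (x i)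
  have h3 : HasFDerivAt f (fderiv ℝ f x) (fun i => x i + (0 : ℝ)) := by
    simpa using hf.hasFDerivAt
  rw [hsum]
  exact h3.comp_hasDerivAt (0 : ℝ) h2

theorem singularGaussian_translate {ι : Type*} [Fintype ι] (γ t : ι → ℝ) (s u : ℝ) :
    singularGaussian γ (fun i => t i + s) (u + s) =
      Real.exp (-(2 * u * s + s ^ 2)) * singularGaussian γ t u := by
  unfold singularGaussian
  rw [← mul_assoc, ← Real.exp_add]
  congr 1
  · congr 1
    ring
  · simp only [add_sub_add_right_eq_sub]

theorem functional_singularGaussian_translate {ι : Type*} [Fintype ι] [Nonempty ι] {γ : ι → ℝ}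
    (hγ : ∀ j, 0 < γ j) (t : ι → ℝ) (s : ℝ) (q : ℝ[X]) :
    (hasExpMoments_singularGaussian hγ fun i => t i + s).functional q =
      ((hasExpMoments_singularGaussian hγ t).gauss_shift_mul s).functional
        (q.comp (X + C s)) := by
  rw [HasExpMoments.functional_apply, HasExpMoments.functional_apply,
    ← integral_add_right_eq_self _ s]
  simp [singularGaussian_translate]

theorem functional_singularGaussian_div_translate {ι : Type*} [Fintype ι] {γ : ι → ℝ}
    (hγ : ∀ j, 0 < γ j) (t : ι → ℝ) (j : ι) (s : ℝ) (q : ℝ[X]) :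
    (hasExpMoments_singularGaussian_div hγ (fun i => t i + s) j).functional q =
      ((hasExpMoments_singularGaussian_div hγ t j).gauss_shift_mul s).functional
        (q.comp (X + C s)) := by
  rw [HasExpMoments.functional_apply, HasExpMoments.functional_apply,
    ← integral_add_right_eq_self _ s]
  simp [singularGaussian_translate, mul_div_assoc]

theorem riccati_r
    (N : ℕ) (hN : 1 ≤ N) (γ : Fin N → ℝ) (hγ : ∀ j, 0 < γ j)
    (U : Set (Fin N → ℝ)) (hU : IsOpen U) (hUinj : ∀ x ∈ U, Function.Injective x)
    (w : (Fin N → ℝ) → ℝ → ℝ)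
    (hw : ∀ x ∈ U, ∀ y : ℝ, w x y = Real.exp (-y ^ 2) * ∏ j, |y - x j| ^ γ j)
    (P : ℕ → (Fin N → ℝ) → Polynomial ℝ)
    (hPmonic : ∀ n, ∀ x ∈ U, (P n x).Monic) (hPdeg : ∀ n, ∀ x ∈ U, (P n x).natDegree = n)
    (horth : ∀ m n, m ≠ n → ∀ x ∈ U, ∫ y : ℝ, (P m x).eval y * (P n x).eval y * w x y = 0)
    (h : ℕ → (Fin N → ℝ) → ℝ)
    (hh : ∀ n, ∀ x ∈ U, h n x = ∫ y : ℝ, ((P n x).eval y) ^ 2 * w x y)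
    (hhpos : ∀ n, ∀ x ∈ U, 0 < h n x)
    (β : ℕ → (Fin N → ℝ) → ℝ) (hβ0 : ∀ x ∈ U, β 0 x = 0)
    (hβ : ∀ n, ∀ x ∈ U, β (n + 1) x = h (n + 1) x / h n x)
    (α : ℕ → (Fin N → ℝ) → ℝ)
    (hα : ∀ n, ∀ x ∈ U, α n x = (∫ y : ℝ, y * ((P n x).eval y) ^ 2 * w x y) / h n x)
    (p : ℕ → (Fin N → ℝ) → ℝ) (hp0 : ∀ x ∈ U, p 0 x = 0)
    (hp : ∀ n, ∀ x ∈ U, p (n + 1) x = (P (n + 1) x).coeff n)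
    (R : ℕ → Fin N → (Fin N → ℝ) → ℝ)
    (hR : ∀ n j, ∀ x ∈ U, R n j x = γ j / h n x * ∫ y : ℝ, ((P n x).eval y) ^ 2 * w x y / (y - x j))
    (r : ℕ → Fin N → (Fin N → ℝ) → ℝ) (hr0 : ∀ j, ∀ x ∈ U, r 0 j x = 0)
    (hr : ∀ n j, ∀ x ∈ U, r (n + 1) j x = γ j / h n x * ∫ y : ℝ, (P (n + 1) x).eval y * (P n x).eval y * w x y / (y - x j))
    (hPC2 : ∀ m k, ContDiffOn ℝ 2 (fun x => (P m x).coeff k) U)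
    (hhC2 : ∀ m, ContDiffOn ℝ 2 (h m) U)
    (hαC2 : ∀ m, ContDiffOn ℝ 2 (α m) U)
    (hβC2 : ∀ m, ContDiffOn ℝ 2 (β m) U)
    (hpC2 : ∀ m, ContDiffOn ℝ 2 (p m) U)
    (hRC2 : ∀ m j, ContDiffOn ℝ 2 (R m j) U)
    (hrC2 : ∀ m j, ContDiffOn ℝ 2 (r m j) U)
    (n : ℕ) (hn : 1 ≤ n) (j : Fin N) (x : Fin N → ℝ) (hx : x ∈ U) (hRne : R n j x ≠ 0) :
    (∑ k, pd k (r n j) x) = 2 * r n j x * (r n j x - γ j) / R n j x - ((n : ℝ) + ∑ k, r n k x) * R n j x := by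
  have hj : Nonempty (Fin N) := ⟨j⟩
  obtain ⟨m, rfl⟩ : ∃ m, n = m + 1 := ⟨n - 1, by omega⟩
  let hW := fun z : Fin N → ℝ => hasExpMoments_singularGaussian hγ z
  let hV := fun (z : Fin N → ℝ) k => hasExpMoments_singularGaussian_div hγ z k
  have hw' : ∀ z ∈ U, w z = singularGaussian γ z := fun z hz => funext (hw z hz)
  have hO : ∀ z ∈ U, IsMonicOrthogonal (hW z).functional fun n => P n z := fun z hz =>
    { monic := fun n => hPmonic n z hz
      natDegree := fun n => hPdeg n z hz
      orthogonal := fun a b hab => by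
        rw [HasExpMoments.functional_apply, ← hw' z hz, ← horth a b hab z hz]
        simp only [eval_mul] }
  have hh' : ∀ n, ∀ z ∈ U, h n z = (hW z).functional (P n z * P n z) := fun n z hz => by
    rw [hh n z hz, HasExpMoments.functional_apply, hw' z hz]
    simp only [eval_mul, sq]
  have hR' : ∀ n k, ∀ z ∈ U, R n k z = γ k / h n z * (hV z k).functional (P n z * P n z) :=
    fun n k z hz => by
      rw [hR n k z hz, HasExpMoments.functional_apply, hw' z hz]
      simp only [eval_mul, sq, mul_div_assoc]
  have hr' : ∀ n k, ∀ z ∈ U,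
      r (n + 1) k z = γ k / h n z * (hV z k).functional (P (n + 1) z * P n z) :=
    fun n k z hz => by
      rw [hr n k z hz, HasExpMoments.functional_apply, hw' z hz]
      simp only [eval_mul, mul_div_assoc]
  have hUs : ∀ᶠ s in 𝓝 (0 : ℝ), (fun i => x i + s) ∈ U := by
    have hc : Continuous fun s : ℝ => fun i => x i + s := by fun_prop
    exact hc.continuousAt.eventually (hU.mem_nhds (by simpa using hx))
  have hline : ∀ n k, DifferentiableAt ℝ (fun s : ℝ => (P n fun i => x i + s).coeff k) 0 :=
    fun n k => (hasDerivAt_diagonal (((hPC2 n k).contDiffAt (hU.mem_nhds hx)).differentiableAt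
      two_ne_zero)).differentiableAt
  let Q : ℕ → ℝ → ℝ[X] := fun n s => (P n fun i => x i + s).comp (X + C s)
  have hQ0 : ∀ n, Q n 0 = P n x := fun n => by simp [Q]
  have hQ : ∀ᶠ s in 𝓝 (0 : ℝ),
      IsMonicOrthogonal ((hW x).gauss_shift_mul s).functional fun n => Q n s := by
    filter_upwards [hUs] with s hs
    refine ⟨fun n => (hPmonic n _ hs).comp_X_add_C s, fun n => ?_, fun a b hab => ?_⟩
    · rw [natDegree_comp, natDegree_X_add_C, mul_one, hPdeg n _ hs]
    · rw [← mul_comp, ← functional_singularGaussian_translate hγ]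
      exact (hO _ hs).orthogonal a b hab
  have hQD : ∀ n, ∃ D : ℝ[X], ∀ k, HasDerivAt (fun s => (Q n s).coeff k) (D.coeff k) 0 :=
    fun n => exists_polynomial_hasDerivAt_coeff (d := n)
      (hQ.mono fun s hs => (hs.natDegree n).le)
      (differentiableAt_coeff_comp_X_add_C (d := n) (hUs.mono fun s hs => (hPdeg n _ hs).le)
        (hline n))
  choose D hD using hQD
  have hF : IsGaussFlow (hW x) Q D := ⟨hQ, hD, fun n => by
    rw [hQ0, ← hh' n x hx]
    exact (hhpos n x hx).ne'⟩
  have hδ : (∑ k, pd k (r (m + 1) j) x) =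
      γ j * (2 * (h (m + 1) x / h m x * (hV x j).functional (P m x * P m x) -
        (hV x j).functional (P (m + 1) x * P (m + 1) x)) / h m x) := by
    have h1 := hasDerivAt_diagonal
      (((hrC2 (m + 1) j).contDiffAt (hU.mem_nhds hx)).differentiableAt two_ne_zero)
    have h2 := (hF.hasDerivAt_quotient (hV x j) m).const_mul (γ j)
    simp only [hQ0, ← hh' _ x hx] at h2
    refine h1.unique (h2.congr_of_eventuallyEq ?_)
    filter_upwards [hUs] with s hs
    rw [hr' m j _ hs, hh' m _ hs, functional_singularGaussian_translate hγ,
      functional_singularGaussian_div_translate hγ, mul_comp, mul_comp]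
    ring
  have hquad := (hO x hx).cauchy_transform_identity (V := (hV x j).functional) (t := x j)
    (fun q => by
      simp only [HasExpMoments.functional_apply, eval_mul, eval_sub, eval_X, eval_C]
      refine integral_congr_ae (.of_forall fun u => ?_)
      beta_reduce
      rw [mul_right_comm, sub_mul_singularGaussian_div x (hγ j), mul_comm]) m
  have hsum : ((m + 1 : ℕ) : ℝ) + ∑ k, r (m + 1) k x = 2 * (h (m + 1) x / h m x) := by
    have hpearson := singularGaussian_pearson hγ x (P (m + 1) x * P m x)
    have hdeg1 : (derivative (P (m + 1) x)).natDegree ≤ m :=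
      (natDegree_derivative_le _).trans (by rw [hPdeg _ x hx]; omega)
    have hdeg2 : (derivative (P m x)).natDegree < m + 1 :=
      (natDegree_derivative_le _).trans_lt (by rw [hPdeg _ x hx]; omega)
    have hc : (derivative (P (m + 1) x)).coeff m = m + 1 := by
      rw [coeff_derivative, (hO x hx).coeff_self, one_mul]
    have hc' : (P m x).coeff m = 1 := (hO x hx).coeff_self m
    rw [derivative_mul, map_add, mul_comm (derivative _),
      (hO x hx).apply_mul_of_natDegree_le hdeg1 le_rfl,
      (hO x hx).apply_mul_of_natDegree_lt hdeg2, hc, mul_left_comm X,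
      (hO x hx).apply_succ_mul_X_mul (hPdeg m x hx).le, hc', ← hh' _ x hx, ← hh' _ x hx]
      at hpearson
    have hrsum : ∑ k, r (m + 1) k x =
        (∑ k, γ k * (hV x k).functional (P (m + 1) x * P m x)) / h m x := by
      rw [Finset.sum_div]
      exact Finset.sum_congr rfl fun k _ => by rw [hr' m k x hx]; ring
    have hm := (hhpos m x hx).ne'
    rw [hrsum]
    push_cast
    field_simp
    linarith
  have hm := (hhpos m x hx).ne'
  have hm1 := (hhpos (m + 1) x hx).ne'
  rw [← hh' m x hx] at hquad
  rw [hR' _ _ x hx] at hRne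
  rw [hδ, hsum, hR' _ _ x hx, hr' _ _ x hx]
  have hA := right_ne_zero_of_mul hRne
  have hγj := (hγ j).ne'
  field_simp
  linear_combination (-h (m + 1) x) * hquad
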